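/- arXiv:1312.4550 — 2 statements merged into one kernel-verified Lean document; each statement's English description precedes it below -/
import Mathlib

section
/- Let d ≥ 1, R ∈ ℕ, and let u : ℤ^d → ℝ be harmonic on the ball B_R, i.e. (Δu)(x) = 0 for every x with ‖x‖₁ ≤ R − 1. Define Q_u(n) = (Aⁿ(u²))(0) for 0 ≤ n ≤ R. Then Q_u is absolutely monotonic in [0,R] in the discrete sense: for all k, n ∈ ℕ with k + n ≤ R, the iterated forward difference satisfies Q_u^{(k)}(n) ≥ 0. -/
/-- The standard generators of `ℤ^d`: `±e_i`, indexed by `Fin d × Bool`. -/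
def latticeGen (d : ℕ) (s : Fin d × Bool) : Fin d → ℤ :=
  fun j => if s.1 = j then (if s.2 then 1 else -1) else 0

/-- The averaging operator `(A f)(x) = (1/(2d)) ∑_{s ∈ S} f(x+s)`. -/
noncomputable def latticeAvg (d : ℕ) (f : (Fin d → ℤ) → ℝ) : (Fin d → ℤ) → ℝ :=
  fun x => (1 / (2 * (d : ℝ))) * ∑ s : Fin d × Bool, f (x + latticeGen d s)

/-- The discrete Laplacian `Δf = Af − f`. -/
noncomputable def latticeLap (d : ℕ) (f : (Fin d → ℤ) → ℝ) : (Fin d → ℤ) → ℝ :=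
  fun x => latticeAvg d f x - f x

/-- The growth function `Q_u(n) = (Aⁿ (u²))(0)`. -/
noncomputable def growthQ (d : ℕ) (u : (Fin d → ℤ) → ℝ) (n : ℕ) : ℝ :=
  (latticeAvg d)^[n] (fun y => (u y) ^ 2) 0

/-- Forward difference of a function on `ℕ`. -/
def fdiff (g : ℕ → ℝ) : ℕ → ℝ := fun n => g (n + 1) - g n

/-- Translating by a generator raises the `ℓ¹`-norm by at most one. -/
lemma l1_add_latticeGen_le {d : ℕ} (x : Fin d → ℤ) (s : Fin d × Bool) :
    ∑ i, |(x + latticeGen d s) i| ≤ (∑ i, |x i|) + 1 := by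
  have h : ∑ i, |latticeGen d s i| = 1 := by
    have : ∀ i, |latticeGen d s i| = if s.1 = i then 1 else 0 := by
      intro i
      unfold latticeGen
      split_ifs <;> simp
    simp [this]
  calc ∑ i, |(x + latticeGen d s) i| ≤ ∑ i, (|x i| + |latticeGen d s i|) :=
        Finset.sum_le_sum fun i _ => abs_add_le _ _
    _ = _ := by rw [Finset.sum_add_distrib, h]

lemma latticeAvg_sub (d : ℕ) (f g : (Fin d → ℤ) → ℝ) :
    latticeAvg d (f - g) = latticeAvg d f - latticeAvg d g := by
  funext x
  simp [latticeAvg, Finset.sum_sub_distrib, mul_sub]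

lemma latticeAvg_iterate_sub (d n : ℕ) (f g : (Fin d → ℤ) → ℝ) :
    (latticeAvg d)^[n] (f - g) = (latticeAvg d)^[n] f - (latticeAvg d)^[n] g := by
  induction n generalizing f g with
  | zero => rfl
  | succ n ih => simp only [Function.iterate_succ_apply, latticeAvg_sub, ih]

lemma latticeAvg_iterate_nonneg {d : ℕ} (n : ℕ) {g : (Fin d → ℤ) → ℝ} {r : ℤ}
    (hg : ∀ y : Fin d → ℤ, ∑ i, |y i| ≤ r + n → 0 ≤ g y) {x : Fin d → ℤ}
    (hx : ∑ i, |x i| ≤ r) : 0 ≤ (latticeAvg d)^[n] g x := by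
  induction n generalizing g with
  | zero => exact hg x (by simpa using hx)
  | succ n ih =>
    rw [Function.iterate_succ_apply]
    refine ih fun y hy => mul_nonneg (by positivity) (Finset.sum_nonneg fun s _ => hg _ ?_)
    have := l1_add_latticeGen_le y s
    push_cast
    linarith

/-- Iterated differences of `n ↦ Aⁿ f` are given by powers of the Laplacian. -/
lemma fdiff_iterate_latticeAvg (d k n : ℕ) (f : (Fin d → ℤ) → ℝ) (x : Fin d → ℤ) :
    fdiff^[k] (fun m => (latticeAvg d)^[m] f x) n
      = (latticeAvg d)^[n] ((latticeLap d)^[k] f) x := by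
  induction k generalizing n with
  | zero => rfl
  | succ k ih =>
    have h : latticeLap d ((latticeLap d)^[k] f)
        = latticeAvg d ((latticeLap d)^[k] f) - (latticeLap d)^[k] f := rfl
    rw [Function.iterate_succ_apply', Function.iterate_succ_apply', h, latticeAvg_iterate_sub]
    simp only [fdiff, ih, Function.iterate_succ_apply, Pi.sub_apply]

/-- `Δᵏ f` on a ball depends only on `f` on the ball of radius larger by `k`. -/
lemma latticeLap_iterate_congr {d : ℕ} (k : ℕ) {f g : (Fin d → ℤ) → ℝ} {r : ℤ}
    (hfg : ∀ y : Fin d → ℤ, ∑ i, |y i| ≤ r + k → f y = g y) {x : Fin d → ℤ}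
    (hx : ∑ i, |x i| ≤ r) : (latticeLap d)^[k] f x = (latticeLap d)^[k] g x := by
  induction k generalizing f g with
  | zero => exact hfg x (by simpa using hx)
  | succ k ih =>
    rw [Function.iterate_succ_apply, Function.iterate_succ_apply]
    refine ih fun y hy => ?_
    push_cast at hfg
    have h : ∀ s, f (y + latticeGen d s) = g (y + latticeGen d s) := fun s =>
      hfg _ (by have := l1_add_latticeGen_le y s; linarith)
    simp only [latticeLap, latticeAvg, h, hfg y (by linarith)]

lemma latticeLap_const_mul_sum {d : ℕ} {ι : Type*} [Fintype ι] (c : ℝ)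
    (F : ι → (Fin d → ℤ) → ℝ) :
    latticeLap d (fun x => c * ∑ s, F s x) = fun x => c * ∑ s, latticeLap d (F s) x := by
  funext x
  simp only [latticeLap, latticeAvg, Finset.sum_sub_distrib, ← Finset.mul_sum]
  rw [Finset.sum_comm]
  ring

lemma latticeLap_iterate_const_mul_sum {d : ℕ} {ι : Type*} [Fintype ι] (k : ℕ) (c : ℝ)
    (F : ι → (Fin d → ℤ) → ℝ) :
    (latticeLap d)^[k] (fun x => c * ∑ s, F s x)
      = fun x => c * ∑ s, (latticeLap d)^[k] (F s) x := by
  induction k generalizing F with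
  | zero => rfl
  | succ k ih => simp only [Function.iterate_succ_apply, latticeLap_const_mul_sum, ih]

/-- At a point where `v` is harmonic, `Δ(v²)` is the mean square of the increments of `v`. -/
lemma latticeLap_sq {d : ℕ} (hd : 1 ≤ d) {v : (Fin d → ℤ) → ℝ} {x : Fin d → ℤ}
    (hv : latticeLap d v x = 0) :
    latticeLap d (fun y => v y ^ 2) x
      = (1 / (2 * (d : ℝ))) * ∑ s, (v (x + latticeGen d s) - v x) ^ 2 := by
  have hd0 : (d : ℝ) ≠ 0 := by positivity
  have h : ∑ s, v (x + latticeGen d s) = 2 * d * v x := by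
    simp only [latticeLap, latticeAvg] at hv
    field_simp at hv
    linarith
  simp only [latticeLap, latticeAvg, sub_sq, Finset.sum_add_distrib, Finset.sum_sub_distrib,
    ← Finset.mul_sum, ← Finset.sum_mul, h]
  simp only [Finset.sum_const, Finset.card_univ, Fintype.card_prod, Fintype.card_fin,
    Fintype.card_bool, nsmul_eq_mul]
  push_cast
  field_simp
  ring

lemma latticeLap_translate_sub {d : ℕ} (v : (Fin d → ℤ) → ℝ) (a x : Fin d → ℤ) :
    latticeLap d (fun y => v (y + a) - v y) x = latticeLap d v (x + a) - latticeLap d v x := by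
  simp only [latticeLap, latticeAvg, Finset.sum_sub_distrib, add_right_comm x _ a]
  ring

/-- If `v` is harmonic on the ball of radius `r + k`, then `Δᵏ(v²) ≥ 0` on the ball of
radius `r`. -/
lemma latticeLap_iterate_sq_nonneg {d : ℕ} (hd : 1 ≤ d) (k : ℕ) {r : ℤ}
    {v : (Fin d → ℤ) → ℝ}
    (hv : ∀ y : Fin d → ℤ, ∑ i, |y i| ≤ r + k - 1 → latticeLap d v y = 0) {x : Fin d → ℤ}
    (hx : ∑ i, |x i| ≤ r) : 0 ≤ (latticeLap d)^[k] (fun y => v y ^ 2) x := by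
  induction k generalizing v with
  | zero => exact sq_nonneg _
  | succ k ih =>
    push_cast at hv
    rw [Function.iterate_succ_apply, latticeLap_iterate_congr k
      (fun y hy => latticeLap_sq hd (hv y (by linarith))) hx,
      latticeLap_iterate_const_mul_sum k _
        (fun s y => (v (y + latticeGen d s) - v y) ^ 2)]
    refine mul_nonneg (by positivity) (Finset.sum_nonneg fun s _ => ih fun y hy => ?_)
    have := l1_add_latticeGen_le y s
    rw [latticeLap_translate_sub, hv _ (by linarith), hv _ (by linarith), sub_zero]

theorem stmt_6 (d : ℕ) (hd : 1 ≤ d) (R : ℕ) (u : (Fin d → ℤ) → ℝ)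
    (hu : ∀ x : Fin d → ℤ, (∑ i, |x i|) ≤ (R : ℤ) - 1 → latticeLap d u x = 0) :
    ∀ k n : ℕ, k + n ≤ R → 0 ≤ fdiff^[k] (growthQ d u) n := by
  intro k n hkn
  have hkn' : (k : ℤ) + n ≤ R := by exact_mod_cast hkn
  have h := fdiff_iterate_latticeAvg d k n (fun y => u y ^ 2) 0
  change fdiff^[k] (growthQ d u) n = _ at h
  rw [h]
  refine latticeAvg_iterate_nonneg (r := 0) n (fun y hy => ?_) (by simp)
  exact latticeLap_iterate_sq_nonneg hd k (fun z hz => hu z (by linarith)) hy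
end

section
/- Let d ≥ 1, M ∈ ℕ, and let u : ℤ^d → ℝ be a harmonic function, not identically zero, with polynomial growth of degree M, i.e. there are constants C, D > 0 such that |u(x)| ≤ C‖x‖₁^M + D for all x ∈ ℤ^d. Then u cannot vanish identically on the ball B_M: there exists x ∈ ℤ^d with ‖x‖₁ ≤ M and u(x) ≠ 0. -/
theorem latticeAvg_mono (d : ℕ) : Monotone (latticeAvg d) := by
  intro f g h x
  unfold latticeAvg
  gcongr with s
  exact h _

theorem latticeAvg_add (d : ℕ) (f g : (Fin d → ℤ) → ℝ) :
    latticeAvg d (f + g) = latticeAvg d f + latticeAvg d g := by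
  funext x
  simp [latticeAvg, Finset.sum_add_distrib, mul_add]

theorem latticeAvg_smul (d : ℕ) (c : ℝ) (f : (Fin d → ℤ) → ℝ) :
    latticeAvg d (c • f) = c • latticeAvg d f := by
  funext x
  simp [latticeAvg, ← Finset.mul_sum, mul_left_comm]

/-- The iterated averaging operator as a linear map. -/
noncomputable def latticeAvgLin (d n : ℕ) : ((Fin d → ℤ) → ℝ) →ₗ[ℝ] ((Fin d → ℤ) → ℝ) where
  toFun := (latticeAvg d)^[n]
  map_add' f g := by
    induction n generalizing f g with
    | zero => rfl
    | succ n ih => simp only [Function.iterate_succ_apply, latticeAvg_add, ih]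
  map_smul' c f := by
    induction n generalizing f with
    | zero => rfl
    | succ n ih => simp only [Function.iterate_succ_apply, latticeAvg_smul, ih, RingHom.id_apply]

theorem latticeAvg_const {d : ℕ} (hd : 1 ≤ d) (c : ℝ) :
    latticeAvg d (fun _ => c) = fun _ => c := by
  funext x
  have : (d : ℝ) ≠ 0 := by positivity
  simp [latticeAvg]
  field_simp

theorem latticeAvg_sq {d : ℕ} (hd : 1 ≤ d) (u : (Fin d → ℤ) → ℝ)
    (hu : ∀ x, latticeLap d u x = 0) :
    latticeAvg d (fun y => u y ^ 2) = (fun y => u y ^ 2) +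
      (1 / (2 * (d : ℝ))) • ∑ s, fun y => (u (y + latticeGen d s) - u y) ^ 2 := by
  funext x
  have hd' : (d : ℝ) ≠ 0 := by positivity
  have h := hu x
  simp only [latticeLap, latticeAvg] at h
  have h2 : ∑ s, u (x + latticeGen d s) = 2 * d * u x := by
    field_simp at h
    linarith
  simp only [latticeAvg, Pi.add_apply, Pi.smul_apply, Finset.sum_apply, smul_eq_mul, sub_sq,
    Finset.sum_add_distrib, Finset.sum_sub_distrib, ← Finset.sum_mul, ← Finset.mul_sum, h2]
  simp
  field_simp
  ring

theorem latticeLap_diff (d : ℕ) (u : (Fin d → ℤ) → ℝ) (hu : ∀ x, latticeLap d u x = 0)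
    (a x : Fin d → ℤ) : latticeLap d (fun y => u (y + a) - u y) x = 0 := by
  have h1 := hu (x + a)
  have h2 := hu x
  simp only [latticeLap, latticeAvg] at *
  simp only [Finset.sum_sub_distrib, add_right_comm x _ a] at *
  linear_combination h1 - h2

theorem fdiff_growthQ {d : ℕ} (hd : 1 ≤ d) (u : (Fin d → ℤ) → ℝ)
    (hu : ∀ x, latticeLap d u x = 0) :
    fdiff (growthQ d u) = (1 / (2 * (d : ℝ))) •
      ∑ s, growthQ d (fun y => u (y + latticeGen d s) - u y) := by
  funext n
  have h : growthQ d u (n + 1) = latticeAvgLin d n (latticeAvg d (fun y => u y ^ 2)) 0 := rfl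
  rw [fdiff, h, latticeAvg_sq hd u hu, map_add, map_smul, map_sum]
  simp [growthQ, latticeAvgLin]

theorem latticeAvg_iterate_nonneg_s8 (d n : ℕ) {f : (Fin d → ℤ) → ℝ} (hf : 0 ≤ f) :
    0 ≤ (latticeAvg d)^[n] f := by
  have h := (latticeAvg_mono d).iterate n hf
  rwa [show (latticeAvg d)^[n] 0 = 0 from (latticeAvgLin d n).map_zero] at h

theorem fwdDiff_iter_growthQ_nonneg {d : ℕ} (hd : 1 ≤ d) (k : ℕ) (u : (Fin d → ℤ) → ℝ)
    (hu : ∀ x, latticeLap d u x = 0) (n : ℕ) :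
    0 ≤ (fwdDiff (1 : ℕ))^[k] (growthQ d u) n := by
  induction k generalizing u with
  | zero => exact latticeAvg_iterate_nonneg_s8 d n (fun y => sq_nonneg (u y)) 0
  | succ k ih =>
    rw [Function.iterate_succ_apply, show fwdDiff (1 : ℕ) (growthQ d u) = _ from fdiff_growthQ hd u hu,
      fwdDiff_iter_const_smul, fwdDiff_iter_finsetSum, Pi.smul_apply, Finset.sum_apply]
    exact smul_nonneg (by positivity)
      (Finset.sum_nonneg fun s _ => ih _ (latticeLap_diff d u hu _))

/-- A sequence with nonnegative iterated differences at `0`, growing at most like `n ^ M` and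
vanishing at `0, …, M`, is zero. -/
theorem eq_zero_of_fwdDiff_iter_nonneg (g : ℕ → ℝ) (hg : ∀ k, 0 ≤ (fwdDiff (1 : ℕ))^[k] g 0)
    (M : ℕ) (K : ℝ) (hK : ∀ n : ℕ, g n ≤ K * ((n : ℝ) + 1) ^ M) (h0 : ∀ n ≤ M, g n = 0)
    (n : ℕ) : g n = 0 := by
  have newton (n : ℕ) : g n = ∑ k ∈ Finset.range (n + 1), n.choose k • (fwdDiff (1 : ℕ))^[k] g 0 := by
    simpa using shift_eq_sum_fwdDiff_iter 1 g n 0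
  rw [newton]
  refine Finset.sum_eq_zero fun k _ => ?_
  suffices h : (fwdDiff (1 : ℕ))^[k] g 0 = 0 by rw [h, smul_zero]
  rcases le_or_gt k M with hk | hk
  · rw [fwdDiff_iter_eq_sum_shift]
    refine Finset.sum_eq_zero fun j hj => ?_
    rw [h0 _ (by simp at hj ⊢; omega), smul_zero]
  · by_contra hne
    set c := (fwdDiff (1 : ℕ))^[k] g 0 with hc
    have hcpos : 0 < c := lt_of_le_of_ne (hg k) (Ne.symm hne)
    obtain ⟨m, hm⟩ := exists_nat_gt ((k.factorial * (K * ((k : ℝ) + 1) ^ M)) / c)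
    rw [div_lt_iff₀ hcpos] at hm
    have h1 : ((m + k).choose k : ℝ) * c ≤ g (m + k) := by
      rw [newton]
      have := Finset.single_le_sum (f := fun j => (m + k).choose j • (fwdDiff (1 : ℕ))^[j] g 0)
        (fun j _ => nsmul_nonneg (hg j) _)
        (Finset.mem_range.2 (by omega : k < m + k + 1))
      simpa [nsmul_eq_mul] using this
    have h2 : ((m : ℝ) + 1) ^ k ≤ k.factorial * (m + k).choose k := by
      have := Nat.pow_sub_le_descFactorial (m + k) k
      rw [Nat.descFactorial_eq_factorial_mul_choose, show m + k + 1 - k = m + 1 by omega] at this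
      exact_mod_cast this
    have hK0 : 0 ≤ K := by
      have := hK 0
      rw [h0 0 (Nat.zero_le _)] at this
      simpa using this
    have h3 : g (m + k) ≤ K * (((k : ℝ) + 1) ^ M * ((m : ℝ) + 1) ^ M) := by
      refine (hK _).trans ?_
      rw [← mul_pow]
      push_cast
      gcongr
      nlinarith [mul_nonneg (Nat.cast_nonneg (α := ℝ) m) (Nat.cast_nonneg (α := ℝ) k)]
    have h4 : ((m : ℝ) + 1) ^ (M + 1) ≤ ((m : ℝ) + 1) ^ k :=
      pow_le_pow_right₀ (by simp) hk
    have hf : (0 : ℝ) < k.factorial := by positivity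
    have h5 : ((m : ℝ) + 1) ^ M * (((m : ℝ) + 1) * c) ≤
        ((m : ℝ) + 1) ^ M * (k.factorial * (K * ((k : ℝ) + 1) ^ M)) := by
      calc _ = ((m : ℝ) + 1) ^ (M + 1) * c := by ring
        _ ≤ (k.factorial * (m + k).choose k) * c := by gcongr; exact h4.trans h2
        _ = k.factorial * ((m + k).choose k * c) := by ring
        _ ≤ k.factorial * (K * (((k : ℝ) + 1) ^ M * ((m : ℝ) + 1) ^ M)) := by
          exact mul_le_mul_of_nonneg_left (h1.trans h3) hf.le
        _ = _ := by ring
    have h6 := le_of_mul_le_mul_left h5 (by positivity)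
    linarith

/-- The second difference of `(1 + x²)^(m+1)` is `O((1 + x²)^m)`. -/
theorem exists_second_diff_bound (m : ℕ) : ∃ K : ℝ, 0 ≤ K ∧ ∀ x : ℝ,
    (1 + (x + 1) ^ 2) ^ (m + 1) + (1 + (x - 1) ^ 2) ^ (m + 1) - 2 * (1 + x ^ 2) ^ (m + 1)
      ≤ K * (1 + x ^ 2) ^ m ∧
    x * ((1 + (x + 1) ^ 2) ^ (m + 1) - (1 + (x - 1) ^ 2) ^ (m + 1)) ≤ K * (1 + x ^ 2) ^ (m + 1) := by
  induction m with
  | zero => exact ⟨4, by norm_num, fun x => ⟨by ring_nf; norm_num, by ring_nf; linarith⟩⟩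
  | succ m ih =>
    obtain ⟨K, hK, h⟩ := ih
    refine ⟨4 * K + 4, by positivity, fun x => ?_⟩
    obtain ⟨hT, hU⟩ := h x
    set c := 1 + x ^ 2 with hc
    set T := (1 + (x + 1) ^ 2) ^ (m + 1) + (1 + (x - 1) ^ 2) ^ (m + 1) - 2 * c ^ (m + 1) with hTd
    set U := x * ((1 + (x + 1) ^ 2) ^ (m + 1) - (1 + (x - 1) ^ 2) ^ (m + 1)) with hUd
    have hc1 : 1 ≤ c := by nlinarith [sq_nonneg x]
    have hxc : x ^ 2 ≤ c := by linarith
    have e1 : (1 + (x + 1) ^ 2) ^ (m + 1 + 1) + (1 + (x - 1) ^ 2) ^ (m + 1 + 1)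
        - 2 * c ^ (m + 1 + 1) = (c + 1) * T + 2 * c ^ (m + 1) + 2 * U := by
      rw [hTd, hUd, hc]; ring
    have e2 : x * ((1 + (x + 1) ^ 2) ^ (m + 1 + 1) - (1 + (x - 1) ^ 2) ^ (m + 1 + 1))
        = (c + 1) * U + 2 * x ^ 2 * (T + 2 * c ^ (m + 1)) := by
      rw [hTd, hUd, hc]; ring
    have hp : 0 < c ^ m := by positivity
    have hT1 : (c + 1) * T ≤ 2 * c * (K * c ^ m) :=
      calc (c + 1) * T ≤ (c + 1) * (K * c ^ m) := by gcongr
        _ ≤ _ := by gcongr; linarith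
    have hU1 : (c + 1) * U ≤ 2 * c * (K * c ^ (m + 1)) :=
      calc (c + 1) * U ≤ (c + 1) * (K * c ^ (m + 1)) := by gcongr
        _ ≤ _ := by gcongr; linarith
    have hT2 : 2 * x ^ 2 * (T + 2 * c ^ (m + 1)) ≤ 2 * c * (K * c ^ m + 2 * c ^ (m + 1)) :=
      calc _ ≤ 2 * x ^ 2 * (K * c ^ m + 2 * c ^ (m + 1)) := by gcongr
        _ ≤ _ := by gcongr
    have hm1 : c ^ (m + 1) ≤ c ^ (m + 2) := pow_le_pow_right₀ hc1 (by omega)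
    rw [e1, e2]
    constructor
    · have : 0 < c ^ (m + 1) := by positivity
      have e : 2 * c * (K * c ^ m) = 2 * K * c ^ (m + 1) := by ring
      nlinarith
    · have e : 2 * c * (K * c ^ m + 2 * c ^ (m + 1)) = 2 * K * c ^ (m + 1) + 4 * c ^ (m + 2) := by
        ring
      have e' : 2 * c * (K * c ^ (m + 1)) = 2 * K * c ^ (m + 2) := by ring
      have := mul_le_mul_of_nonneg_left hm1 (by positivity : 0 ≤ 2 * K)
      show _ ≤ (4 * K + 4) * c ^ (m + 2)
      linarith

/-- The weight `∑ᵢ (1 + xᵢ²)^m`. -/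
def latticeWeight (d m : ℕ) (x : Fin d → ℤ) : ℝ := ∑ i, (1 + (x i : ℝ) ^ 2) ^ m

theorem latticeAvg_latticeWeight_le {d : ℕ} (hd : 1 ≤ d) (m : ℕ) : ∃ K : ℝ, 0 ≤ K ∧
    latticeAvg d (latticeWeight d (m + 1)) ≤ latticeWeight d (m + 1) + K • latticeWeight d m := by
  obtain ⟨K, hK, h⟩ := exists_second_diff_bound m
  refine ⟨K, hK, fun x => ?_⟩
  have hd' : (1 : ℝ) ≤ d := by exact_mod_cast hd
  have key (i : Fin d) : ∑ s, ((1 + ((x + latticeGen d s) i : ℝ) ^ 2) ^ (m + 1)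
      - (1 + (x i : ℝ) ^ 2) ^ (m + 1)) ≤ K * (1 + (x i : ℝ) ^ 2) ^ m := by
    rw [Fintype.sum_prod_type, Finset.sum_eq_single i]
    · refine le_trans (le_of_eq ?_) (h (x i)).1
      simp [latticeGen]
      ring
    · intro j _ hj
      simp [latticeGen, hj]
    · simp
  have hs : ∑ s, (latticeWeight d (m + 1) (x + latticeGen d s) - latticeWeight d (m + 1) x)
      ≤ K * latticeWeight d m x := by
    simp only [latticeWeight, ← Finset.sum_sub_distrib]
    rw [Finset.sum_comm, Finset.mul_sum]
    exact Finset.sum_le_sum fun i _ => key i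
  have hw : 0 ≤ K * latticeWeight d m x := by unfold latticeWeight; positivity
  rw [Finset.sum_sub_distrib] at hs
  simp only [Finset.sum_const, Finset.card_univ, Fintype.card_prod, Fintype.card_fin,
    Fintype.card_bool, nsmul_eq_mul] at hs
  push_cast at hs
  simp only [latticeAvg, Pi.add_apply, Pi.smul_apply, smul_eq_mul]
  rw [one_div, inv_mul_le_iff₀ (by positivity)]
  nlinarith

theorem latticeAvg_iterate_latticeWeight_le {d : ℕ} (hd : 1 ≤ d) (m : ℕ) : ∃ K : ℝ, 0 ≤ K ∧
    ∀ n : ℕ, (latticeAvg d)^[n] (latticeWeight d m) 0 ≤ K * ((n : ℝ) + 1) ^ m := by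
  induction m with
  | zero =>
    refine ⟨d, by positivity, fun n => ?_⟩
    have h : latticeWeight d 0 = fun _ => (d : ℝ) := by
      funext x
      simp [latticeWeight]
    rw [h, Function.iterate_fixed (latticeAvg_const hd _)]
    simp
  | succ m ih =>
    obtain ⟨K₁, hK₁, h₁⟩ := ih
    obtain ⟨K₂, hK₂, h₂⟩ := latticeAvg_latticeWeight_le hd m
    refine ⟨d + K₂ * K₁, by positivity, fun n => ?_⟩
    induction n with
    | zero =>
      have : 0 ≤ K₂ * K₁ := by positivity
      simpa [latticeWeight] using this
    | succ n ihn =>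
      have h := (latticeAvg_mono d).iterate n h₂ 0
      have e : (latticeAvg d)^[n] (latticeWeight d (m + 1) + K₂ • latticeWeight d m) =
          (latticeAvg d)^[n] (latticeWeight d (m + 1)) +
            K₂ • (latticeAvg d)^[n] (latticeWeight d m) := by
        change latticeAvgLin d n _ = latticeAvgLin d n _ + K₂ • latticeAvgLin d n _
        rw [map_add, map_smul]
      rw [e] at h
      rw [Function.iterate_succ_apply]
      refine h.trans ?_
      simp only [Pi.add_apply, Pi.smul_apply, smul_eq_mul]
      have h3 := mul_le_mul_of_nonneg_left (h₁ n) hK₂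
      have hp : ((n : ℝ) + 1) ^ m ≤ ((n : ℝ) + 1 + 1) ^ m := by gcongr; linarith
      have hp0 : 0 ≤ ((n : ℝ) + 1) ^ m := by positivity
      have h4 : ((n : ℝ) + 1) ^ (m + 1) + ((n : ℝ) + 1) ^ m ≤ ((n : ℝ) + 1 + 1) ^ (m + 1) :=
        calc _ = ((n : ℝ) + 1) ^ m * ((n : ℝ) + 1 + 1) := by ring
          _ ≤ ((n : ℝ) + 1 + 1) ^ m * ((n : ℝ) + 1 + 1) := by gcongr
          _ = _ := by ring
      push_cast
      have h5 := mul_le_mul_of_nonneg_left h4 (by positivity : 0 ≤ (d : ℝ) + K₂ * K₁)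
      have h6 : 0 ≤ (d : ℝ) * ((n : ℝ) + 1) ^ m := by positivity
      nlinarith

theorem norm_pow_le_latticeWeight {d : ℕ} (hd : 1 ≤ d) (M : ℕ) (x : Fin d → ℤ) :
    (((∑ i, |x i| : ℤ) : ℝ) ^ M) ^ 2 ≤ ((d : ℝ) ^ M) ^ 2 * latticeWeight d M x := by
  have : Nonempty (Fin d) := ⟨⟨0, hd⟩⟩
  obtain ⟨j, hj⟩ := Finite.exists_max fun i => |x i|
  have h1 : ((∑ i, |x i| : ℤ) : ℝ) ≤ d * |(x j : ℝ)| := by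
    have : ∑ i, |x i| ≤ d * |x j| := by
      simpa using Finset.sum_le_card_nsmul Finset.univ (fun i => |x i|) _ fun i _ => hj i
    exact_mod_cast this
  have h0 : (0 : ℝ) ≤ ((∑ i, |x i| : ℤ) : ℝ) := by
    exact_mod_cast Finset.sum_nonneg fun i _ => abs_nonneg (x i)
  calc (((∑ i, |x i| : ℤ) : ℝ) ^ M) ^ 2 ≤ ((d * |(x j : ℝ)|) ^ M) ^ 2 := by gcongr
    _ = ((d : ℝ) ^ M) ^ 2 * ((x j : ℝ) ^ 2) ^ M := by
      rw [← sq_abs (x j : ℝ)]; ring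
    _ ≤ ((d : ℝ) ^ M) ^ 2 * latticeWeight d M x := by
      gcongr
      calc ((x j : ℝ) ^ 2) ^ M ≤ (1 + (x j : ℝ) ^ 2) ^ M := by gcongr; linarith
        _ ≤ _ := Finset.single_le_sum (f := fun i => (1 + (x i : ℝ) ^ 2) ^ M)
          (fun i _ => by positivity) (Finset.mem_univ j)

theorem one_le_latticeWeight {d : ℕ} (hd : 1 ≤ d) (M : ℕ) (x : Fin d → ℤ) :
    1 ≤ latticeWeight d M x := by
  calc (1 : ℝ) ≤ (1 + (x ⟨0, hd⟩ : ℝ) ^ 2) ^ M :=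
        one_le_pow₀ (by nlinarith [sq_nonneg (x ⟨0, hd⟩ : ℝ)])
    _ ≤ _ := Finset.single_le_sum (f := fun i => (1 + (x i : ℝ) ^ 2) ^ M)
          (fun i _ => by positivity) (Finset.mem_univ _)

theorem growthQ_le {d : ℕ} (hd : 1 ≤ d) (M : ℕ) (u : (Fin d → ℤ) → ℝ) (C D : ℝ)
    (h : ∀ x : Fin d → ℤ, |u x| ≤ C * ((∑ i, |x i| : ℤ) : ℝ) ^ M + D) :
    ∃ K : ℝ, ∀ n : ℕ, growthQ d u n ≤ K * ((n : ℝ) + 1) ^ M := by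
  obtain ⟨K, hK, hw⟩ := latticeAvg_iterate_latticeWeight_le hd M
  set L : ℝ := 2 * C ^ 2 * ((d : ℝ) ^ M) ^ 2 + 2 * D ^ 2 with hL
  have hu : (fun y => u y ^ 2) ≤ L • latticeWeight d M := by
    intro x
    have h1 := norm_pow_le_latticeWeight hd M x
    have h2 := one_le_latticeWeight hd M x
    have h3 := pow_le_pow_left₀ (abs_nonneg _) (h x) 2
    rw [sq_abs] at h3
    simp only [Pi.smul_apply, smul_eq_mul]
    set t := ((∑ i, |x i| : ℤ) : ℝ) ^ M
    have h4 := mul_le_mul_of_nonneg_left h1 (by positivity : 0 ≤ 2 * C ^ 2)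
    have h5 := mul_le_mul_of_nonneg_left h2 (by positivity : 0 ≤ 2 * D ^ 2)
    rw [hL]
    nlinarith [sq_nonneg (C * t - D)]
  refine ⟨L * K, fun n => ?_⟩
  have h1 := (latticeAvg_mono d).iterate n hu 0
  have e : (latticeAvg d)^[n] (L • latticeWeight d M) = L • (latticeAvg d)^[n] (latticeWeight d M) :=
    (latticeAvgLin d n).map_smul _ _
  rw [e] at h1
  refine h1.trans ?_
  rw [mul_assoc]
  exact mul_le_mul_of_nonneg_left (hw n) (by positivity)

theorem norm_latticeGen (d : ℕ) (s : Fin d × Bool) : ∑ i, |latticeGen d s i| = 1 := by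
  rw [Finset.sum_eq_single s.1]
  · rcases s with ⟨i, b⟩
    cases b <;> simp [latticeGen]
  · intro j _ hj
    simp [latticeGen, hj.symm]
  · simp

theorem latticeAvg_iterate_eq_zero (d n : ℕ) (f : (Fin d → ℤ) → ℝ)
    (hf : ∀ x : Fin d → ℤ, ∑ i, |x i| ≤ (n : ℤ) → f x = 0) : (latticeAvg d)^[n] f 0 = 0 := by
  induction n generalizing f with
  | zero => exact hf 0 (by simp)
  | succ n ih =>
    rw [Function.iterate_succ_apply]
    refine ih _ fun x hx => ?_
    rw [latticeAvg, Finset.sum_eq_zero, mul_zero]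
    intro s _
    refine hf _ ?_
    calc ∑ i, |(x + latticeGen d s) i| ≤ ∑ i, (|x i| + |latticeGen d s i|) :=
          Finset.sum_le_sum fun i _ => abs_add_le _ _
      _ ≤ _ := by
        rw [Finset.sum_add_distrib, norm_latticeGen]
        push_cast
        linarith

theorem exists_add_latticeGen {d n : ℕ} (x : Fin d → ℤ) (hx : ∑ i, |x i| = ((n + 1 : ℕ) : ℤ)) :
    ∃ (y : Fin d → ℤ) (s : Fin d × Bool), ∑ i, |y i| = (n : ℤ) ∧ x = y + latticeGen d s := by
  obtain ⟨j, hj⟩ : ∃ j, x j ≠ 0 := by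
    by_contra! h
    simp [h] at hx
    omega
  refine ⟨x - latticeGen d (j, decide (0 < x j)), (j, decide (0 < x j)), ?_, by simp⟩
  have h : ∑ i, (|x i| - |(x - latticeGen d (j, decide (0 < x j))) i|) = 1 := by
    rw [Finset.sum_eq_single j]
    · rcases lt_or_gt_of_ne hj with h | h
      · simp [latticeGen, h.not_gt]
        rw [abs_of_neg h, abs_of_nonpos (by omega)]
        ring
      · simp [latticeGen, h]
        rw [abs_of_pos h, abs_of_nonneg (by omega)]
        ring
    · intro i _ hi
      simp [latticeGen, hi.symm]
    · simp
  rw [Finset.sum_sub_distrib, hx] at h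
  push_cast at h
  linarith

theorem eq_zero_of_latticeAvg_iterate_eq_zero {d : ℕ} (hd : 1 ≤ d) (n : ℕ) (f : (Fin d → ℤ) → ℝ)
    (hf : 0 ≤ f) (h : (latticeAvg d)^[n] f 0 = 0) (x : Fin d → ℤ) (hx : ∑ i, |x i| = (n : ℤ)) :
    f x = 0 := by
  induction n generalizing f x with
  | zero =>
    have hx0 : x = 0 := by
      funext i
      have := (Finset.sum_eq_zero_iff_of_nonneg fun i _ => abs_nonneg (x i)).1 hx i
        (Finset.mem_univ i)
      simpa using this
    rw [hx0]
    exact h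
  | succ n ih =>
    obtain ⟨y, s, hy, rfl⟩ := exists_add_latticeGen x hx
    have h1 := ih _ (latticeAvg_iterate_nonneg_s8 d 1 hf) h y hy
    have hd' : (d : ℝ) ≠ 0 := by positivity
    have h2 : ∑ s, f (y + latticeGen d s) = 0 := by
      simpa [latticeAvg, hd'] using h1
    exact (Finset.sum_eq_zero_iff_of_nonneg fun t _ => hf (y + latticeGen d t)).1 h2 s (Finset.mem_univ s)

theorem stmt_8 (d : ℕ) (hd : 1 ≤ d) (M : ℕ) (u : (Fin d → ℤ) → ℝ)
    (hu : ∀ x, latticeLap d u x = 0)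
    (hne : ∃ x, u x ≠ 0)
    (hgrowth : ∃ C D : ℝ, 0 < C ∧ 0 < D ∧
      ∀ x : Fin d → ℤ, |u x| ≤ C * ((∑ i, |x i| : ℤ) : ℝ) ^ M + D) :
    ∃ x : Fin d → ℤ, (∑ i, |x i|) ≤ (M : ℤ) ∧ u x ≠ 0 := by
  by_contra! hvan
  obtain ⟨x, hx⟩ := hne
  obtain ⟨C, D, -, -, hCD⟩ := hgrowth
  obtain ⟨K, hK⟩ := growthQ_le hd M u C D hCD
  obtain ⟨n, hn⟩ := Int.eq_ofNat_of_zero_le (Finset.sum_nonneg fun i _ => abs_nonneg (x i))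
  have hQ : growthQ d u n = 0 := by
    refine eq_zero_of_fwdDiff_iter_nonneg _ (fun k => fwdDiff_iter_growthQ_nonneg hd k u hu 0)
      M K hK (fun m hm => latticeAvg_iterate_eq_zero d m _ fun y hy => ?_) n
    rw [hvan y (hy.trans (by exact_mod_cast hm)), zero_pow two_ne_zero]
  exact hx (pow_eq_zero_iff two_ne_zero |>.1
    (eq_zero_of_latticeAvg_iterate_eq_zero hd n _ (fun y => sq_nonneg (u y)) hQ x hn))
end
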